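/- arXiv:1810.08308 — 2 statements merged into one kernel-verified Lean document; each statement's English description precedes it below -/
import Mathlib

section
/- Let z = E₀ + κ + iη with η > 0, and let m(z) = A(z) + √(B(z)) where A, B are analytic in a neighborhood of E₀, B has a simple zero at E₀, and m is the Stieltjes transform of a probability measure supported in (-∞, E₀]. Then Im[m(z)] is comparable to Im[√(z - E₀)]; in particular there exist constants c, C > 0 such that for |κ| + η small: if κ ≤ 0 then c√(|κ|+η) ≤ Im[m(z)] ≤ C√(|κ|+η), and if κ ≥ 0 then cη/√(|κ|+η) ≤ Im[m(z)] ≤ Cη/√(|κ|+η). -/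
open MeasureTheory Complex

open Filter Topology

lemma norm_one_div_ofReal_sub_le (x : ℝ) {z : ℂ} (hz : 0 < z.im) :
    ‖(1 : ℂ) / ((x : ℂ) - z)‖ ≤ 1 / z.im := by
  rw [norm_div, norm_one]
  refine one_div_le_one_div_of_le hz ?_
  have h := Complex.abs_im_le_norm ((x : ℂ) - z)
  simp only [sub_im, ofReal_im, zero_sub, abs_neg] at h
  exact (le_abs_self _).trans h

lemma one_div_ofReal_sub_im (x : ℝ) (z : ℂ) :
    ((1 : ℂ) / ((x : ℂ) - z)).im = z.im / ((x - z.re) ^ 2 + z.im ^ 2) := by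
  simp [Complex.inv_im, Complex.normSq_apply, pow_two]

lemma aestronglyMeasurable_one_div_ofReal_sub (ρ : Measure ℝ) (z : ℂ) :
    AEStronglyMeasurable (fun x : ℝ => (1 : ℂ) / ((x : ℂ) - z)) ρ := by
  have h : Measurable (fun x : ℝ => (1 : ℂ) / ((x : ℂ) - z)) := by fun_prop
  exact h.aestronglyMeasurable

lemma integrable_one_div_ofReal_sub (ρ : Measure ℝ) [IsFiniteMeasure ρ] {z : ℂ} (hz : 0 < z.im) :
    Integrable (fun x : ℝ => (1 : ℂ) / ((x : ℂ) - z)) ρ :=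
  Integrable.of_bound (aestronglyMeasurable_one_div_ofReal_sub ρ z) (1 / z.im)
    (Eventually.of_forall fun x => norm_one_div_ofReal_sub_le x hz)

lemma integral_one_div_ofReal_sub_im (ρ : Measure ℝ) [IsFiniteMeasure ρ] {z : ℂ} (hz : 0 < z.im) :
    (∫ x : ℝ, (1 : ℂ) / ((x : ℂ) - z) ∂ρ).im
      = ∫ x : ℝ, z.im / ((x - z.re) ^ 2 + z.im ^ 2) ∂ρ := by
  have h := Complex.imCLM.integral_comp_comm (integrable_one_div_ofReal_sub ρ hz)
  simp only [Complex.imCLM_apply, one_div_ofReal_sub_im] at h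
  exact h.symm

lemma integral_one_div_ofReal_sub_im_nonneg (ρ : Measure ℝ) [IsFiniteMeasure ρ] {z : ℂ}
    (hz : 0 < z.im) : 0 ≤ (∫ x : ℝ, (1 : ℂ) / ((x : ℂ) - z) ∂ρ).im := by
  rw [integral_one_div_ofReal_sub_im ρ hz]
  exact integral_nonneg fun x => by positivity

lemma integral_one_div_ofReal_sub_im_le (ρ : Measure ℝ) [IsProbabilityMeasure ρ] {E : ℝ}
    (hsupp : ρ (Set.Ioi E) = 0) {z : ℂ} (hz : 0 < z.im) (hE : E < z.re) :
    (∫ x : ℝ, (1 : ℂ) / ((x : ℂ) - z) ∂ρ).im ≤ z.im / (z.re - E) ^ 2 := by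
  rw [integral_one_div_ofReal_sub_im ρ hz]
  have hae : ∀ᵐ x ∂ρ, x ≤ E := by
    rw [ae_iff]
    simp only [not_le]
    exact hsupp
  have hle : ∀ᵐ x ∂ρ, z.im / ((x - z.re) ^ 2 + z.im ^ 2) ≤ z.im / (z.re - E) ^ 2 := by
    filter_upwards [hae] with x hx
    have h1 : 0 < z.re - E := sub_pos.2 hE
    refine div_le_div_of_nonneg_left hz.le (by positivity) ?_
    nlinarith [sq_nonneg z.im]
  have h := integral_mono_of_nonneg (Eventually.of_forall fun x => by positivity)
    (integrable_const (z.im / (z.re - E) ^ 2)) hle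
  simpa using h

lemma continuousOn_integral_one_div_ofReal_sub (ρ : Measure ℝ) [IsFiniteMeasure ρ] :
    ContinuousOn (fun z : ℂ => ∫ x : ℝ, (1 : ℂ) / ((x : ℂ) - z) ∂ρ) {z | 0 < z.im} := by
  intro z hz
  have hz : 0 < z.im := hz
  refine ContinuousAt.continuousWithinAt ?_
  have hev : ∀ᶠ w : ℂ in 𝓝 z, z.im / 2 < w.im :=
    Complex.continuous_im.continuousAt.eventually (lt_mem_nhds (half_lt_self hz))
  refine continuousAt_of_dominated (bound := fun _ => 1 / (z.im / 2))
    (Eventually.of_forall fun w => aestronglyMeasurable_one_div_ofReal_sub ρ w) ?_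
    (integrable_const _) ?_
  · filter_upwards [hev] with w hw
    refine Eventually.of_forall fun x => ?_
    refine (norm_one_div_ofReal_sub_le x (by linarith)).trans ?_
    exact one_div_le_one_div_of_le (by positivity) hw.le
  · refine Eventually.of_forall fun x => ?_
    refine continuousAt_const.div (continuousAt_const.sub continuousAt_id) fun h => ?_
    have := congrArg Complex.im h
    simp at this
    exact hz.ne' this

lemma exists_analyticAt_sq_eq_comp_sq {B : ℂ → ℂ} {e : ℂ} (hB : AnalyticAt ℂ B e) (hB0 : B e = 0)
    (hB' : deriv B e ≠ 0) :
    ∃ G : ℂ → ℂ, ∃ b : ℂ, b ≠ 0 ∧ HasStrictDerivAt G b 0 ∧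
      (∀ᶠ ζ in 𝓝 (0 : ℂ), ContinuousAt G ζ) ∧ ∀ᶠ ζ in 𝓝 (0 : ℂ), G ζ ^ 2 = B (e + ζ ^ 2) := by
  obtain ⟨p, hp⟩ := hB
  have hg : AnalyticAt ℂ (dslope B e) e := ⟨_, hp.has_fpower_series_dslope_fslope⟩
  have hge : dslope B e e = deriv B e := dslope_same B e
  obtain ⟨b, hb⟩ := IsAlgClosed.exists_pow_nat_eq (deriv B e) (n := 2) two_pos
  have hb0 : b ≠ 0 := by rintro rfl; exact hB' (by simpa using hb.symm)
  set u : ℂ → ℂ := fun ζ => dslope B e (e + ζ ^ 2) / deriv B e with hu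
  have hu0 : u 0 = 1 := by simp [hu, hB']
  have huan : AnalyticAt ℂ u 0 := by
    have h1 : AnalyticAt ℂ (fun ζ : ℂ => e + ζ ^ 2) 0 := by fun_prop
    exact (AnalyticAt.comp_of_eq hg h1 (by simp)).div_const
  have hk : AnalyticAt ℂ (fun ζ => b * u ζ ^ (1 / 2 : ℂ)) 0 :=
    analyticAt_const.mul (huan.cpow analyticAt_const (by rw [hu0]; exact one_mem_slitPlane))
  have hG : AnalyticAt ℂ (fun ζ => ζ * (b * u ζ ^ (1 / 2 : ℂ))) 0 := analyticAt_id.mul hk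
  refine ⟨fun ζ => ζ * (b * u ζ ^ (1 / 2 : ℂ)), b, hb0, ?_,
    hG.eventually_continuousAt, ?_⟩
  · have h := (hasStrictDerivAt_id (0 : ℂ)).mul hk.hasStrictDerivAt
    simp only [id_eq, zero_mul, add_zero, one_mul, hu0, one_cpow, mul_one] at h
    exact h
  · refine Eventually.of_forall fun ζ => ?_
    have h2 : (u ζ ^ (1 / 2 : ℂ)) ^ 2 = u ζ := by
      rw [one_div]
      exact Complex.cpow_nat_inv_pow (u ζ) two_ne_zero
    have h3 := sub_smul_dslope B e (e + ζ ^ 2)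
    simp only [add_sub_cancel_left, smul_eq_mul, hB0, sub_zero] at h3
    rw [mul_pow, mul_pow, h2, hb, hu, ← h3]
    field_simp

lemma eventually_im_comparable {F : ℂ → ℂ} {b : ℂ} (hF : HasStrictDerivAt F b 0) (hb : b ≠ 0)
    (hreal : ∀ᶠ ζ in 𝓝 (0 : ℂ), 0 < ζ.re → (F (ζ.re : ℂ)).im = 0)
    (hpos : ∀ᶠ ζ in 𝓝 (0 : ℂ), 0 < ζ.re → 0 < ζ.im → 0 ≤ (F ζ).im) :
    ∃ a : ℝ, 0 < a ∧ ∀ᶠ ζ in 𝓝 (0 : ℂ), 0 < ζ.re → 0 < ζ.im →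
      a / 2 * ζ.im ≤ (F ζ).im ∧ (F ζ).im ≤ 2 * a * ζ.im := by
  have hlo : ∀ ε : ℝ, 0 < ε → ∀ᶠ p in 𝓝 ((0 : ℂ), (0 : ℂ)),
      ‖F p.1 - F p.2 - b * (p.1 - p.2)‖ ≤ ε * ‖p.1 - p.2‖ := by
    intro ε hε
    have h := hF.isLittleO.def hε
    simpa [mul_comm] using h
  have hre : Tendsto (fun ζ : ℂ => (ζ.re : ℂ)) (𝓝 0) (𝓝 0) := by
    have : Continuous fun ζ : ℂ => (ζ.re : ℂ) := by fun_prop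
    simpa using this.tendsto 0
  have key : ∀ ε : ℝ, 0 < ε → ∀ᶠ ζ in 𝓝 (0 : ℂ), 0 < ζ.re → 0 < ζ.im →
      |(F ζ).im - b.re * ζ.im| ≤ ε * ζ.im := by
    intro ε hε
    have ht : Tendsto (fun ζ : ℂ => (ζ, (ζ.re : ℂ))) (𝓝 0) (𝓝 (0, 0)) := by
      rw [nhds_prod_eq]
      exact tendsto_id.prodMk hre
    filter_upwards [ht.eventually (hlo ε hε), hreal] with ζ h1 h2 hr hi
    have h3 : ζ - (ζ.re : ℂ) = ζ.im * I := by
      apply Complex.ext <;> simp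
    have h4 := (Complex.abs_im_le_norm _).trans h1
    simp only [h3] at h4
    simpa [h2 hr, abs_of_pos hi] using h4
  have hbim : b.im = 0 := by
    by_contra hne
    have hε : 0 < |b.im| / 2 := by positivity
    have ht : Tendsto (fun r : ℝ => ((r : ℂ), ((r / 2 : ℝ) : ℂ))) (𝓝[>] 0) (𝓝 (0, 0)) := by
      have : Continuous fun r : ℝ => ((r : ℂ), ((r / 2 : ℝ) : ℂ)) := by fun_prop
      have := this.tendsto 0
      simp only [zero_div, ofReal_zero] at this
      exact this.mono_left nhdsWithin_le_nhds
    have ht1 : Tendsto (fun r : ℝ => (r : ℂ)) (𝓝[>] 0) (𝓝 0) :=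
      (Complex.continuous_ofReal.tendsto' 0 0 (by simp)).mono_left nhdsWithin_le_nhds
    have ht2 : Tendsto (fun r : ℝ => ((r / 2 : ℝ) : ℂ)) (𝓝[>] 0) (𝓝 0) := by
      have : Continuous fun r : ℝ => ((r / 2 : ℝ) : ℂ) := by fun_prop
      exact (this.tendsto' 0 0 (by simp)).mono_left nhdsWithin_le_nhds
    obtain ⟨r, h1, h2, h3, hr⟩ := ((ht.eventually (hlo _ hε)).and ((ht1.eventually hreal).and
      ((ht2.eventually hreal).and self_mem_nhdsWithin))).exists
    have hr : 0 < r := hr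
    have h4 : (r : ℂ) - ((r / 2 : ℝ) : ℂ) = ((r / 2 : ℝ) : ℂ) := by
      push_cast; ring
    have h5 := (Complex.abs_im_le_norm _).trans h1
    simp only [h4, ofReal_re] at h5 h2 h3
    rw [sub_im, sub_im, h2 hr, h3 (by positivity), im_mul_ofReal, Complex.norm_real,
      Real.norm_eq_abs, sub_zero, zero_sub, abs_neg, abs_mul] at h5
    have h6 : 0 < |r / 2| := by positivity
    have h7 : 0 < |b.im| := by positivity
    nlinarith
  have hbre : b.re ≠ 0 := fun h => hb (Complex.ext h hbim)
  have hbpos : 0 < b.re := by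
    by_contra hle
    have hneg : b.re < 0 := lt_of_le_of_ne (not_lt.1 hle) hbre
    have ht : Tendsto (fun r : ℝ => (⟨r, r⟩ : ℂ)) (𝓝[>] 0) (𝓝 0) := by
      have h : Continuous fun r : ℝ => (r : ℂ) + r * I := by fun_prop
      have h' : (fun r : ℝ => (⟨r, r⟩ : ℂ)) = fun r : ℝ => (r : ℂ) + r * I := by
        funext r; exact Complex.mk_eq_add_mul_I r r
      rw [h']
      exact (h.tendsto' 0 0 (by simp)).mono_left nhdsWithin_le_nhds
    obtain ⟨r, h1, h2, hr⟩ := ((ht.eventually (key (-b.re / 2) (by linarith))).and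
      ((ht.eventually hpos).and self_mem_nhdsWithin)).exists
    have hr : 0 < r := hr
    have h3 := h1 hr hr
    have h4 := h2 hr hr
    have h5 := (abs_le.1 h3).2
    simp only at h4 h5
    nlinarith
  refine ⟨b.re, hbpos, ?_⟩
  filter_upwards [key (b.re / 2) (by positivity)] with ζ h hr hi
  have h1 := abs_le.1 (h hr hi)
  have h2 : 0 < b.re * ζ.im := by positivity
  constructor <;> nlinarith [h1.1, h1.2]

lemma exists_pos_sq_eq {w : ℂ} (hw : 0 < w.im) : ∃ ζ : ℂ, 0 < ζ.re ∧ 0 < ζ.im ∧ ζ ^ 2 = w := by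
  obtain ⟨ζ, hζ⟩ := IsAlgClosed.exists_pow_nat_eq w (n := 2) two_pos
  have him : 0 < 2 * (ζ.re * ζ.im) := by
    have := congrArg Complex.im hζ
    simp only [pow_two, mul_im] at this
    linarith
  rcases pos_and_pos_or_neg_and_neg_of_mul_pos (pos_of_mul_pos_right him (by norm_num))
    with h | h
  · exact ⟨ζ, h.1, h.2, hζ⟩
  · exact ⟨-ζ, by simpa using h.1, by simpa using h.2, by simpa using hζ⟩

/-- If a function `F` represents `m` in the square root coordinate `ζ = √(z - E)`, then its strict
differentiability at `0` makes `Im m` comparable to `Im ζ`. -/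
lemma eventually_im_comparable_of_stieltjes (ρ : Measure ℝ) [IsProbabilityMeasure ρ] {E : ℝ}
    (hsupp : ρ (Set.Ioi E) = 0) {F : ℂ → ℂ} {b : ℂ} (hF : HasStrictDerivAt F b 0) (hb : b ≠ 0)
    (hFc : ∀ᶠ ζ in 𝓝 (0 : ℂ), ContinuousAt F ζ)
    (hFm : ∀ᶠ ζ in 𝓝 (0 : ℂ), 0 < ζ.re → 0 < ζ.im →
      F ζ = ∫ x : ℝ, (1 : ℂ) / ((x : ℂ) - (E + ζ ^ 2)) ∂ρ) :
    ∃ a : ℝ, 0 < a ∧ ∀ᶠ ζ in 𝓝 (0 : ℂ), 0 < ζ.re → 0 < ζ.im →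
      a / 2 * ζ.im ≤ (F ζ).im ∧ (F ζ).im ≤ 2 * a * ζ.im := by
  have him : ∀ ζ : ℂ, ((E : ℂ) + ζ ^ 2).im = 2 * (ζ.re * ζ.im) := by
    intro ζ; simp [pow_two]; ring
  have hre : ∀ ζ : ℂ, ((E : ℂ) + ζ ^ 2).re = E + (ζ.re ^ 2 - ζ.im ^ 2) := by
    intro ζ; simp [pow_two]
  refine eventually_im_comparable hF hb ?_ ?_
  · have hretend : Tendsto (fun ζ : ℂ => (ζ.re : ℂ)) (𝓝 0) (𝓝 0) := by
      have : Continuous fun ζ : ℂ => (ζ.re : ℂ) := by fun_prop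
      simpa using this.tendsto 0
    filter_upwards [hretend.eventually hFm.eventually_nhds, hretend.eventually hFc]
      with ζ hm hc hr
    set r := ζ.re
    have ht : Tendsto (fun ε : ℝ => (r : ℂ) + ε * I) (𝓝[>] 0) (𝓝 (r : ℂ)) := by
      have h : Continuous fun ε : ℝ => (r : ℂ) + ε * I := by fun_prop
      exact (h.tendsto' 0 _ (by simp)).mono_left nhdsWithin_le_nhds
    have hlim : Tendsto (fun ε : ℝ => (F ((r : ℂ) + ε * I)).im) (𝓝[>] 0) (𝓝 (F (r : ℂ)).im) :=
      (Complex.continuous_im.tendsto _).comp (hc.tendsto.comp ht)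
    have hbd : Tendsto (fun ε : ℝ => 2 * (r * ε) / (r ^ 2 - ε ^ 2) ^ 2) (𝓝[>] 0) (𝓝 0) := by
      have h : ContinuousAt (fun ε : ℝ => 2 * (r * ε) / (r ^ 2 - ε ^ 2) ^ 2) 0 := by
        refine ContinuousAt.div (by fun_prop) (by fun_prop) ?_
        have : 0 < r := hr
        simp only [ne_eq, OfNat.ofNat_ne_zero, not_false_eq_true, zero_pow, sub_zero]
        positivity
      have h' := h.tendsto
      simp only [mul_zero, zero_div] at h'
      exact h'.mono_left nhdsWithin_le_nhds
    have hsmall : ∀ᶠ ε : ℝ in 𝓝[>] 0, ε < r :=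
      nhdsWithin_le_nhds (gt_mem_nhds hr)
    have hzero : Tendsto (fun ε : ℝ => (F ((r : ℂ) + ε * I)).im) (𝓝[>] 0) (𝓝 0) := by
      refine tendsto_of_tendsto_of_tendsto_of_le_of_le' tendsto_const_nhds hbd ?_ ?_
      · filter_upwards [ht.eventually hm, self_mem_nhdsWithin] with ε hε hpos
        have hpos : 0 < ε := hpos
        rw [hε (by simpa using hr) (by simpa using hpos)]
        refine integral_one_div_ofReal_sub_im_nonneg ρ ?_
        rw [him]
        have : 0 < r * ε := mul_pos hr hpos
        simpa using this
      · filter_upwards [ht.eventually hm, self_mem_nhdsWithin, hsmall] with ε hε hpos hlt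
        have hpos : 0 < ε := hpos
        rw [hε (by simpa using hr) (by simpa using hpos)]
        have h := integral_one_div_ofReal_sub_im_le ρ hsupp
          (z := (E : ℂ) + ((r : ℂ) + ε * I) ^ 2) (by
            rw [him]
            have : 0 < r * ε := mul_pos hr hpos
            simpa using this) (by
            rw [hre]
            have : 0 < r ^ 2 - ε ^ 2 := by nlinarith
            simpa using this)
        rw [him, hre] at h
        simpa using h
    exact tendsto_nhds_unique hlim hzero
  · filter_upwards [hFm] with ζ h hr hi
    rw [h hr hi]
    refine integral_one_div_ofReal_sub_im_nonneg ρ ?_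
    rw [him]
    positivity

lemma le_sqrt_abs_add_and_sqrt_le {p q : ℝ} (hq : 0 < q) (hp : 0 < p)
    (hqp : q ≤ p) :
    p ≤ √(|p ^ 2 - q ^ 2| + 2 * (p * q)) ∧ √(|p ^ 2 - q ^ 2| + 2 * (p * q)) ≤ 2 * p := by
  rw [abs_of_nonneg (by nlinarith)]
  constructor
  · apply Real.le_sqrt_of_sq_le
    nlinarith
  · rw [Real.sqrt_le_left (by positivity)]
    nlinarith [sq_nonneg (p - q)]

theorem stmt_0 (ρ : Measure ℝ) [IsProbabilityMeasure ρ] (E₀ : ℝ)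
    (hsupp : ρ (Set.Ioi E₀) = 0)
    (m A B S : ℂ → ℂ)
    (hm : ∀ z : ℂ, 0 < z.im → m z = ∫ x : ℝ, (1 : ℂ) / ((x : ℂ) - z) ∂ρ)
    (hA : AnalyticAt ℂ A (E₀ : ℂ)) (hB : AnalyticAt ℂ B (E₀ : ℂ))
    (hB0 : B (E₀ : ℂ) = 0) (hB0' : deriv B (E₀ : ℂ) ≠ 0)
    (hrep : ∃ U ∈ nhds (E₀ : ℂ), ∀ z ∈ U, 0 < z.im →
      m z = A z + S z ∧ S z ^ 2 = B z ∧ 0 ≤ (S z).im) :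
    ∃ c C δ : ℝ, 0 < c ∧ 0 < C ∧ 0 < δ ∧
      ∀ κ η : ℝ, 0 < η → |κ| + η < δ →
        ((κ ≤ 0 →
            c * Real.sqrt (|κ| + η) ≤ (m ((E₀ : ℂ) + κ + η * Complex.I)).im ∧
            (m ((E₀ : ℂ) + κ + η * Complex.I)).im ≤ C * Real.sqrt (|κ| + η)) ∧
         (0 ≤ κ →
            c * η / Real.sqrt (|κ| + η) ≤ (m ((E₀ : ℂ) + κ + η * Complex.I)).im ∧
            (m ((E₀ : ℂ) + κ + η * Complex.I)).im ≤ C * η / Real.sqrt (|κ| + η))) := by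
  obtain ⟨U, hU, hrep⟩ := hrep
  obtain ⟨G, b, hb, hG, hGc, hGsq⟩ := exists_analyticAt_sq_eq_comp_sq hB hB0 hB0'
  have hsqt : Tendsto (fun ζ : ℂ => (E₀ : ℂ) + ζ ^ 2) (𝓝 0) (𝓝 (E₀ : ℂ)) := by
    have h : Continuous fun ζ : ℂ => (E₀ : ℂ) + ζ ^ 2 := by fun_prop
    exact h.tendsto' 0 _ (by simp)
  have hAan : AnalyticAt ℂ (fun ζ : ℂ => A ((E₀ : ℂ) + ζ ^ 2)) 0 := by
    have h1 : AnalyticAt ℂ (fun ζ : ℂ => (E₀ : ℂ) + ζ ^ 2) 0 := by fun_prop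
    exact AnalyticAt.comp_of_eq hA h1 (by simp)
  have hA' : HasStrictDerivAt (fun ζ : ℂ => A ((E₀ : ℂ) + ζ ^ 2)) 0 0 := by
    have h1 : HasStrictDerivAt (fun ζ : ℂ => (E₀ : ℂ) + ζ ^ 2) 0 0 := by
      have := ((hasStrictDerivAt_id (0 : ℂ)).pow 2).const_add (E₀ : ℂ)
      simpa using this
    have h2 : HasStrictDerivAt A (deriv A E₀) ((E₀ : ℂ) + 0 ^ 2) := by
      simpa using hA.hasStrictDerivAt
    have h3 := h2.comp 0 h1
    rw [mul_zero] at h3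
    exact h3
  have hGne : ∀ᶠ ζ in 𝓝 (0 : ℂ), ζ ≠ 0 → G ζ ≠ 0 := by
    have h := hG.hasDerivAt.eventually_ne (c := 0) hb
    exact eventually_nhdsWithin_iff.1 h
  have hall := (hsqt.eventually hU).and (hGc.and (hGsq.and (hGne.and
    hAan.eventually_continuousAt)))
  obtain ⟨r, hr, hball⟩ := Metric.eventually_nhds_iff_ball.1 hall
  set Q : Set ℂ := {ζ | 0 < ζ.re} ∩ {ζ | 0 < ζ.im} ∩ Metric.ball 0 r with hQ
  have hQpre : IsPreconnected Q :=
    (((convex_halfSpace_re_gt 0).inter (convex_halfSpace_im_gt 0)).inter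
      (convex_ball 0 r)).isPreconnected
  have him : ∀ ζ : ℂ, ((E₀ : ℂ) + ζ ^ 2).im = 2 * (ζ.re * ζ.im) := by
    intro ζ; simp [pow_two]; ring
  have himQ : ∀ ζ ∈ Q, 0 < ((E₀ : ℂ) + ζ ^ 2).im := by
    rintro ζ ⟨⟨h1, h2⟩, -⟩
    rw [him]
    have : 0 < ζ.re * ζ.im := mul_pos h1 h2
    linarith
  have hmc : ContinuousOn (fun ζ : ℂ => m ((E₀ : ℂ) + ζ ^ 2)) Q := by
    have h1 : ContinuousOn m {z | 0 < z.im} :=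
      (continuousOn_integral_one_div_ofReal_sub ρ).congr fun z hz => hm z hz
    exact h1.comp (by fun_prop) himQ
  have hAc : ContinuousOn (fun ζ : ℂ => A ((E₀ : ℂ) + ζ ^ 2)) Q :=
    fun ζ hζ => (hball ζ hζ.2).2.2.2.2.continuousWithinAt
  have hsign := hQpre.eq_or_eq_neg_of_sq_eq (hmc.sub hAc)
    (fun ζ hζ => (hball ζ hζ.2).2.1.continuousWithinAt)
    (fun ζ hζ => by
      have h := hrep _ (hball ζ hζ.2).1 (himQ ζ hζ)
      simp only [Pi.pow_apply, Pi.sub_apply]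
      rw [(hball ζ hζ.2).2.2.1, h.1, add_sub_cancel_left, h.2.1])
    (fun {ζ} hζ => (hball ζ hζ.2).2.2.2.1 (by
      rintro rfl
      simpa using hζ.1.1))
  have hF : ∃ F : ℂ → ℂ, ∃ b' : ℂ, b' ≠ 0 ∧ HasStrictDerivAt F b' 0 ∧
      (∀ᶠ ζ in 𝓝 (0 : ℂ), ContinuousAt F ζ) ∧ ∀ ζ ∈ Q, F ζ = m ((E₀ : ℂ) + ζ ^ 2) := by
    rcases hsign with h | h
    · refine ⟨fun ζ => A ((E₀ : ℂ) + ζ ^ 2) + G ζ, b, hb, by have := hA'.add hG; rwa [zero_add] at this, ?_, ?_⟩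
      · filter_upwards [hGc, hAan.eventually_continuousAt] with ζ h1 h2 using h2.add h1
      · intro ζ hζ
        have := h hζ
        simp only [Pi.sub_apply] at this
        simp only [← this, add_sub_cancel]
    · refine ⟨fun ζ => A ((E₀ : ℂ) + ζ ^ 2) - G ζ, -b, neg_ne_zero.2 hb,
        by have := hA'.sub hG; rwa [zero_sub] at this, ?_, ?_⟩
      · filter_upwards [hGc, hAan.eventually_continuousAt] with ζ h1 h2 using h2.sub h1
      · intro ζ hζ
        have := h hζ
        simp only [Pi.sub_apply, Pi.neg_apply] at this
        simp only [sub_eq_add_neg (A _) (G ζ), ← this, add_sub_cancel]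
  obtain ⟨F, b', hb', hFd, hFc, hFQ⟩ := hF
  obtain ⟨a, ha, hcomp⟩ := eventually_im_comparable_of_stieltjes ρ hsupp hFd hb' hFc (by
    filter_upwards [Metric.ball_mem_nhds (0 : ℂ) hr] with ζ hζ h1 h2
    rw [hFQ ζ ⟨⟨h1, h2⟩, hζ⟩, hm _ (himQ ζ ⟨⟨h1, h2⟩, hζ⟩)])
  obtain ⟨t, ht, hcomp⟩ := Metric.eventually_nhds_iff_ball.1 hcomp
  refine ⟨a / 4, 2 * a, min r t ^ 2, by positivity, by positivity, by positivity, ?_⟩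
  intro κ η hη hs
  obtain ⟨ζ, hp, hq, hζ⟩ := exists_pos_sq_eq (w := (κ : ℂ) + η * I) (by simpa using hη)
  have hκ : κ = ζ.re ^ 2 - ζ.im ^ 2 := by
    have := congrArg Complex.re hζ
    simp [pow_two] at this
    nlinarith
  have hη' : η = 2 * (ζ.re * ζ.im) := by
    have := congrArg Complex.im hζ
    simp [pow_two] at this
    nlinarith
  have hnorm : ‖ζ‖ < min r t := by
    have h1 : ‖ζ‖ ^ 2 ≤ |κ| + η := by
      rw [← norm_pow, hζ]
      refine (norm_add_le _ _).trans ?_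
      simp [abs_of_pos hη]
    exact lt_of_pow_lt_pow_left₀ 2 (by positivity) (h1.trans_lt hs)
  have hζr : ζ ∈ Metric.ball (0 : ℂ) r := by simpa using hnorm.trans_le (min_le_left _ _)
  have hζt : ζ ∈ Metric.ball (0 : ℂ) t := by simpa using hnorm.trans_le (min_le_right _ _)
  have hb1 := hcomp ζ hζt hp hq
  rw [hFQ ζ ⟨⟨hp, hq⟩, hζr⟩, hζ, ← add_assoc] at hb1
  obtain ⟨hl, hu⟩ := hb1
  constructor
  · intro hκ0
    have h := le_sqrt_abs_add_and_sqrt_le hp hq (by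
      by_contra hlt
      nlinarith [not_le.1 hlt])
    rw [abs_sub_comm, mul_comm ζ.im, ← hκ, ← hη'] at h
    constructor <;> nlinarith [h.1, h.2]
  · intro hκ0
    have h := le_sqrt_abs_add_and_sqrt_le hq hp (by
      by_contra hlt
      nlinarith [not_le.1 hlt])
    rw [← hκ, ← hη'] at h
    have hspos : 0 < √(|κ| + η) := hp.trans_le h.1
    constructor
    · refine le_trans ?_ hl
      rw [div_le_iff₀ hspos]
      have : a * ζ.im * ζ.re ≤ a * ζ.im * √(|κ| + η) :=
        mul_le_mul_of_nonneg_left h.1 (by positivity)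
      nlinarith
    · refine hu.trans ?_
      rw [le_div_iff₀ hspos]
      have : a * ζ.im * √(|κ| + η) ≤ a * ζ.im * (2 * ζ.re) :=
        mul_le_mul_of_nonneg_left h.2 (by positivity)
      nlinarith
end

section
/- For z, z' in the open upper half plane ℂ₊ with principal square roots (positive real part), ∫_{-∞}^{0} √|x| / ((x - z)²(x - z')²) dx = (π/2) · 1/(√z · √z' · (√z + √z')³). -/
open MeasureTheory Complex

open Filter Topology Set

/-- A branch of `t ↦ arctan (t / a)`, valid for all real `t` when `a` has positive real part. -/
noncomputable def arctanDiv (a : ℂ) (t : ℝ) : ℂ :=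
  1 / (2 * I) * (log (a + t * I) - log (a - t * I))

theorem add_sq_ne_zero_of_re_pos {a : ℂ} (ha : 0 < a.re) (t : ℝ) : (t : ℂ) ^ 2 + a ^ 2 ≠ 0 := by
  have h1 : a + t * I ≠ 0 := fun h => by
    have := congrArg re h
    simp at this
    linarith
  have h2 : a - t * I ≠ 0 := fun h => by
    have := congrArg re h
    simp at this
    linarith
  have h : (t : ℂ) ^ 2 + a ^ 2 = (a + t * I) * (a - t * I) := by
    linear_combination (t : ℂ) ^ 2 * I_sq
  rw [h]
  exact mul_ne_zero h1 h2

theorem hasDerivAt_arctanDiv {a : ℂ} (ha : 0 < a.re) (t : ℝ) :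
    HasDerivAt (arctanDiv a) (a / ((t : ℂ) ^ 2 + a ^ 2)) t := by
  have hs1 : a + t * I ∈ slitPlane := Or.inl (by simpa using ha)
  have hs2 : a - t * I ∈ slitPlane := Or.inl (by simpa using ha)
  have ht : HasDerivAt (fun t : ℝ => (t : ℂ) * I) I t := by
    simpa using (hasDerivAt_id t).ofReal_comp.mul_const I
  have h := ((((ht.const_add a).clog_real hs1).sub ((ht.const_sub a).clog_real hs2)).const_mul
    (1 / (2 * I)))
  refine h.congr_deriv ?_
  have h1 := slitPlane_ne_zero hs1
  have h2 := slitPlane_ne_zero hs2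
  have h3 : a + t * I + (a - t * I) = 2 * a := by ring
  have h4 : (t : ℂ) ^ 2 + a ^ 2 = (a + t * I) * (a - t * I) := by
    linear_combination (t : ℂ) ^ 2 * I_sq
  rw [h4]
  generalize a + t * I = u at *
  generalize a - t * I = v at *
  field_simp
  linear_combination h3

theorem arctanDiv_zero (a : ℂ) : arctanDiv a 0 = 0 := by
  simp [arctanDiv]

theorem tendsto_arctanDiv_atTop (a : ℂ) :
    Tendsto (arctanDiv a) atTop (𝓝 (Real.pi / 2)) := by
  have hinv : Tendsto (fun t : ℝ => a * ((t⁻¹ : ℝ) : ℂ)) atTop (𝓝 0) := by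
    simpa using ((continuous_ofReal.tendsto 0).comp tendsto_inv_atTop_zero).const_mul a
  have h1 : Tendsto (fun t : ℝ => log (a * ((t⁻¹ : ℝ) : ℂ) + I)) atTop (𝓝 (log I)) :=
    (continuousAt_clog (Or.inr (by simp))).tendsto.comp (by simpa using hinv.add_const I)
  have h2 : Tendsto (fun t : ℝ => log (a * ((t⁻¹ : ℝ) : ℂ) - I)) atTop (𝓝 (log (-I))) :=
    (continuousAt_clog (Or.inr (by simp))).tendsto.comp (by simpa using hinv.sub_const I)
  have h := (h1.sub h2).const_mul (1 / (2 * I))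
  have e : 1 / (2 * I) * (log I - log (-I)) = Real.pi / 2 := by
    rw [log_I, log_neg_I]
    field_simp
    ring
  rw [e] at h
  refine h.congr' ?_
  filter_upwards [eventually_gt_atTop 0, hinv.eventually (eventually_norm_sub_lt 0 one_pos)]
    with t ht hlt
  have hlt' : ‖a * ((t⁻¹ : ℝ) : ℂ)‖ < 1 := by simpa using hlt
  have ht' : (t : ℂ) ≠ 0 := by exact_mod_cast ht.ne'
  have n1 : a * ((t⁻¹ : ℝ) : ℂ) + I ≠ 0 := fun h0 => by
    rw [eq_neg_of_add_eq_zero_left h0] at hlt'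
    simp at hlt'
  have n2 : a * ((t⁻¹ : ℝ) : ℂ) - I ≠ 0 := fun h0 => by
    rw [sub_eq_zero.mp h0] at hlt'
    simp at hlt'
  have e1 : a + t * I = t * (a * ((t⁻¹ : ℝ) : ℂ) + I) := by
    push_cast
    field_simp
  have e2 : a - t * I = t * (a * ((t⁻¹ : ℝ) : ℂ) - I) := by
    push_cast
    field_simp
  rw [arctanDiv, e1, e2, log_ofReal_mul ht n1, log_ofReal_mul ht n2]
  ring

theorem tendsto_inv_sq_add_atTop (c : ℂ) :
    Tendsto (fun t : ℝ => 1 / ((t : ℂ) ^ 2 + c)) atTop (𝓝 0) := by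
  have h : Tendsto (fun t : ℝ => (t : ℂ) ^ 2 + c) atTop (Bornology.cobounded ℂ) := by
    rw [← tendsto_norm_atTop_iff_cobounded]
    refine tendsto_atTop_mono (fun t => ?_)
      (tendsto_atTop_add_const_right atTop (-‖c‖) (tendsto_pow_atTop (α := ℝ) two_ne_zero))
    have := norm_sub_le ((t : ℂ) ^ 2 + c) c
    rw [add_sub_cancel_right, norm_pow, norm_real, Real.norm_eq_abs, sq_abs] at this
    linarith
  simpa [Function.comp_def] using tendsto_inv₀_cobounded.comp h

theorem tendsto_sq_div_sq_add_atTop {a : ℂ} (ha : 0 < a.re) :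
    Tendsto (fun t : ℝ => (t : ℂ) ^ 2 / ((t : ℂ) ^ 2 + a ^ 2)) atTop (𝓝 1) := by
  have h := ((tendsto_inv_sq_add_atTop (a ^ 2)).const_mul (a ^ 2)).const_sub 1
  simp only [mul_zero, sub_zero] at h
  refine h.congr fun t => ?_
  have := add_sq_ne_zero_of_re_pos ha t
  field_simp
  ring

theorem tendsto_div_sq_add_atTop {a : ℂ} (ha : 0 < a.re) :
    Tendsto (fun t : ℝ => (t : ℂ) / ((t : ℂ) ^ 2 + a ^ 2)) atTop (𝓝 0) := by
  have hinv : Tendsto (fun t : ℝ => ((t⁻¹ : ℝ) : ℂ)) atTop (𝓝 0) := by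
    simpa [Function.comp_def] using (continuous_ofReal.tendsto 0).comp tendsto_inv_atTop_zero
  have h := hinv.mul (tendsto_sq_div_sq_add_atTop ha)
  simp only [zero_mul] at h
  refine h.congr' ?_
  filter_upwards [eventually_gt_atTop 0] with t ht
  have ht' : (t : ℂ) ≠ 0 := by exact_mod_cast ht.ne'
  push_cast
  field_simp

theorem hasDerivAt_div_sq_add_pow {a : ℂ} (ha : 0 < a.re) (n : ℕ) (t : ℝ) :
    HasDerivAt (fun t : ℝ => (t : ℂ) / ((t : ℂ) ^ 2 + a ^ 2) ^ n)
      (1 / ((t : ℂ) ^ 2 + a ^ 2) ^ n - 2 * n * (t : ℂ) ^ 2 / ((t : ℂ) ^ 2 + a ^ 2) ^ (n + 1)) t := by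
  have hq := add_sq_ne_zero_of_re_pos ha t
  have ht : HasDerivAt (fun t : ℝ => (t : ℂ)) 1 t := (hasDerivAt_id t).ofReal_comp
  refine (ht.div (((ht.pow 2).add_const (a ^ 2)).pow n) (pow_ne_zero n hq)).congr_deriv ?_
  cases n with
  | zero => simp
  | succ k =>
    simp
    field_simp
    ring

theorem continuous_integrand {a b : ℂ} (ha : 0 < a.re) (hb : 0 < b.re) :
    Continuous fun t : ℝ =>
      2 * (t : ℂ) ^ 2 / (((t : ℂ) ^ 2 + a ^ 2) ^ 2 * ((t : ℂ) ^ 2 + b ^ 2) ^ 2) := by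
  refine Continuous.div (by fun_prop) (by fun_prop) fun t => ?_
  exact mul_ne_zero (pow_ne_zero 2 (add_sq_ne_zero_of_re_pos ha t))
    (pow_ne_zero 2 (add_sq_ne_zero_of_re_pos hb t))

theorem integrableOn_integrand {a b : ℂ} (ha : 0 < a.re) (hb : 0 < b.re) :
    IntegrableOn (fun t : ℝ =>
      2 * (t : ℂ) ^ 2 / (((t : ℂ) ^ 2 + a ^ 2) ^ 2 * ((t : ℂ) ^ 2 + b ^ 2) ^ 2)) (Ioi 0) := by
  have hO : (fun t : ℝ =>
      2 * (t : ℂ) ^ 2 / (((t : ℂ) ^ 2 + a ^ 2) ^ 2 * ((t : ℂ) ^ 2 + b ^ 2) ^ 2))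
      =O[atTop] fun t : ℝ => t ^ (-2 : ℝ) := by
    have hpow : (fun t : ℝ => ((t ^ (-2 : ℝ) : ℝ) : ℂ)) =O[atTop] fun t : ℝ => t ^ (-2 : ℝ) :=
      Asymptotics.IsBigO.of_norm_left (by simpa using Asymptotics.isBigO_refl _ _)
    have h := ((((tendsto_sq_div_sq_add_atTop ha).pow 2).mul
      ((tendsto_inv_sq_add_atTop (b ^ 2)).pow 2)).const_mul 2).isBigO_one ℝ
    refine (h.mul hpow).congr' ?_ (by simp)
    filter_upwards [eventually_gt_atTop 0] with t ht
    have ht' : (t : ℂ) ≠ 0 := by exact_mod_cast ht.ne'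
    have e : t ^ (-2 : ℝ) = (t ^ 2)⁻¹ := by
      rw [Real.rpow_neg ht.le]
      norm_cast
    rw [e]
    push_cast
    field_simp
  refine IntegrableOn.mono_set ?_ Ioi_subset_Ici_self
  refine ((continuous_integrand ha hb).locallyIntegrable.locallyIntegrableOn
    (Ici 0)).integrableOn_of_isBigO_atTop hO ?_
  exact ⟨Ioi 1, Ioi_mem_atTop 1, integrableOn_Ioi_rpow_of_lt (by norm_num) one_pos⟩

theorem integral_Ioi_sq_div_sq_add_mul_sq_add {a b : ℂ} (ha : 0 < a.re) (hb : 0 < b.re) :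
    ∫ t : ℝ in Ioi 0,
      2 * (t : ℂ) ^ 2 / (((t : ℂ) ^ 2 + a ^ 2) ^ 2 * ((t : ℂ) ^ 2 + b ^ 2) ^ 2)
      = Real.pi / 2 * (1 / (a * b * (a + b) ^ 3)) := by
  have ne0 : ∀ {c : ℂ}, 0 < c.re → c ≠ 0 := fun hc h => by simp [h] at hc
  have ha0 := ne0 ha
  have hb0 := ne0 hb
  have hab0 : a + b ≠ 0 := ne0 (by simpa using add_pos ha hb)
  have hint := integrableOn_integrand ha hb
  have t1 : ∀ {c : ℂ}, 0 < c.re →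
      Tendsto (fun t : ℝ => (t : ℂ) / ((t : ℂ) ^ 2 + c ^ 2) ^ 1) atTop (𝓝 0) := fun hc => by
    simpa using tendsto_div_sq_add_atTop hc
  by_cases hab : a = b
  · subst hab
    have tn : ∀ n : ℕ,
        Tendsto (fun t : ℝ => (t : ℂ) / ((t : ℂ) ^ 2 + a ^ 2) ^ (n + 1)) atTop (𝓝 0) := by
      intro n
      induction n with
      | zero => exact t1 ha
      | succ n ih =>
        have h := ih.mul (tendsto_inv_sq_add_atTop (a ^ 2))
        simp only [zero_mul] at h
        refine h.congr fun t => ?_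
        rw [div_mul_div_comm, mul_one, ← pow_succ]
    have hd : ∀ t : ℝ, HasDerivAt (fun t : ℝ =>
        -1 / 3 * ((t : ℂ) / ((t : ℂ) ^ 2 + a ^ 2) ^ 3)
        + 1 / (12 * a ^ 2) * ((t : ℂ) / ((t : ℂ) ^ 2 + a ^ 2) ^ 2)
        + 1 / (8 * a ^ 4) * ((t : ℂ) / ((t : ℂ) ^ 2 + a ^ 2) ^ 1)
        + 1 / (8 * a ^ 5) * arctanDiv a t)
        (2 * (t : ℂ) ^ 2 / (((t : ℂ) ^ 2 + a ^ 2) ^ 2 * ((t : ℂ) ^ 2 + a ^ 2) ^ 2)) t := by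
      intro t
      have hq := add_sq_ne_zero_of_re_pos ha t
      refine (((((hasDerivAt_div_sq_add_pow ha 3 t).const_mul _).add
        ((hasDerivAt_div_sq_add_pow ha 2 t).const_mul _)).add
        ((hasDerivAt_div_sq_add_pow ha 1 t).const_mul _)).add
        ((hasDerivAt_arctanDiv ha t).const_mul _)).congr_deriv ?_
      push_cast
      field_simp
      ring
    have hlim := ((((tn 2).const_mul (-1 / 3)).add ((tn 1).const_mul (1 / (12 * a ^ 2)))).add
        ((tn 0).const_mul (1 / (8 * a ^ 4)))).add
        ((tendsto_arctanDiv_atTop a).const_mul (1 / (8 * a ^ 5)))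
    rw [integral_Ioi_of_hasDerivAt_of_tendsto (hd 0).continuousAt.continuousWithinAt
      (fun t _ => hd t) hint hlim]
    simp only [arctanDiv_zero, ofReal_zero]
    field_simp
    ring
  · have hd0 : b - a ≠ 0 := sub_ne_zero.mpr (Ne.symm hab)
    have hd : ∀ t : ℝ, HasDerivAt (fun t : ℝ => 2 / ((b - a) * (a + b)) ^ 2 *
        (1 / (2 * a) * arctanDiv a t - 1 / 2 * ((t : ℂ) / ((t : ℂ) ^ 2 + a ^ 2) ^ 1)
        + (1 / (2 * b) * arctanDiv b t - 1 / 2 * ((t : ℂ) / ((t : ℂ) ^ 2 + b ^ 2) ^ 1))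
        + 2 / ((b - a) * (a + b)) * (a * arctanDiv a t - b * arctanDiv b t)))
        (2 * (t : ℂ) ^ 2 / (((t : ℂ) ^ 2 + a ^ 2) ^ 2 * ((t : ℂ) ^ 2 + b ^ 2) ^ 2)) t := by
      intro t
      have hqa := add_sq_ne_zero_of_re_pos ha t
      have hqb := add_sq_ne_zero_of_re_pos hb t
      have da := hasDerivAt_arctanDiv ha t
      have db := hasDerivAt_arctanDiv hb t
      refine ((((da.const_mul _).sub ((hasDerivAt_div_sq_add_pow ha 1 t).const_mul _)).add
        ((db.const_mul _).sub ((hasDerivAt_div_sq_add_pow hb 1 t).const_mul _))).add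
        (((da.const_mul a).sub (db.const_mul b)).const_mul _) |>.const_mul _).congr_deriv ?_
      push_cast
      field_simp
      ring
    have la := tendsto_arctanDiv_atTop a
    have lb := tendsto_arctanDiv_atTop b
    have hlim := ((((la.const_mul (1 / (2 * a))).sub ((t1 ha).const_mul (1 / 2))).add
      ((lb.const_mul (1 / (2 * b))).sub ((t1 hb).const_mul (1 / 2)))).add
      (((la.const_mul a).sub (lb.const_mul b)).const_mul
        (2 / ((b - a) * (a + b))))).const_mul (2 / ((b - a) * (a + b)) ^ 2)
    rw [integral_Ioi_of_hasDerivAt_of_tendsto (hd 0).continuousAt.continuousWithinAt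
      (fun t _ => hd t) hint hlim]
    simp only [arctanDiv_zero, ofReal_zero]
    field_simp
    ring

theorem integral_Iio_eq_integral_Ioi_neg_sq (f : ℝ → ℂ) :
    ∫ x in Iio (0 : ℝ), f x = ∫ t in Ioi (0 : ℝ), (2 * t) • f (-t ^ 2) := by
  have himg : (fun t : ℝ => -t ^ 2) '' Ioi 0 = Iio 0 := by
    ext x
    simp only [mem_image, mem_Ioi, mem_Iio]
    constructor
    · rintro ⟨t, ht, rfl⟩
      have := pow_pos ht 2
      linarith
    · intro hx
      exact ⟨√(-x), Real.sqrt_pos.mpr (by linarith), by rw [Real.sq_sqrt (by linarith)]; ring⟩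
  have hinj : InjOn (fun t : ℝ => -t ^ 2) (Ioi 0) := fun x hx y hy h =>
    (pow_left_inj₀ (le_of_lt hx) (le_of_lt hy) two_ne_zero).mp (neg_injective h)
  have hder : ∀ t ∈ Ioi (0 : ℝ), HasDerivWithinAt (fun t : ℝ => -t ^ 2) (-(2 * t)) (Ioi 0) t :=
    fun t _ => ((hasDerivAt_pow 2 t).neg.congr_deriv (by simp)).hasDerivWithinAt
  rw [← himg, integral_image_eq_integral_abs_deriv_smul measurableSet_Ioi hder hinj]
  refine setIntegral_congr_fun measurableSet_Ioi fun t ht => ?_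
  have ht' : (0 : ℝ) < t := ht
  simp only [abs_neg, abs_of_pos (mul_pos two_pos ht')]

theorem re_cpow_one_half_pos {z : ℂ} (hz : 0 < z.im) : 0 < (z ^ (1 / 2 : ℂ)).re := by
  have h0 : z ≠ 0 := fun h => by simp [h] at hz
  rw [cpow_def_of_ne_zero h0, exp_re]
  refine mul_pos (Real.exp_pos _) (Real.cos_pos_of_mem_Ioo ?_)
  have him : (log z * (1 / 2)).im = z.arg / 2 := by
    rw [one_div, ← div_eq_mul_inv, div_ofNat_im, log_im]
  rw [him]
  have h1 := arg_nonneg_iff.mpr hz.le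
  have h2 := arg_lt_pi_iff.mpr (Or.inr hz.ne')
  constructor <;> linarith [Real.pi_pos]

theorem cpow_one_half_sq (z : ℂ) : (z ^ (1 / 2 : ℂ)) ^ 2 = z := by
  simp

theorem stmt_1 (z z' : ℂ) (hz : 0 < z.im) (hz' : 0 < z'.im) :
    (∫ x in Set.Iio (0:ℝ),
        ((Real.sqrt |x| : ℝ) : ℂ) / (((x : ℂ) - z) ^ 2 * ((x : ℂ) - z') ^ 2))
      = ((Real.pi / 2 : ℝ) : ℂ) *
          (1 / (z ^ (1/2 : ℂ) * z' ^ (1/2 : ℂ) * (z ^ (1/2 : ℂ) + z' ^ (1/2 : ℂ)) ^ 3)) := by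
  have key := integral_Ioi_sq_div_sq_add_mul_sq_add (re_cpow_one_half_pos hz)
    (re_cpow_one_half_pos hz')
  rw [integral_Iio_eq_integral_Ioi_neg_sq]
  push_cast
  rw [← key]
  refine setIntegral_congr_fun measurableSet_Ioi fun t ht => ?_
  have ht' : (0 : ℝ) < t := ht
  simp only [cpow_one_half_sq, abs_neg, abs_sq, Real.sqrt_sq ht'.le, real_smul]
  push_cast
  rw [mul_div_assoc']
  congr 1 <;> ring
end
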